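/- Let H = O_nc(B⁺) with Δ(a)=a⊗a, Δ(d)=d⊗d, Δ(b)=a⊗b+b⊗d. Every finite-dimensional nonzero left H-comodule V contains a semi-invariant, i.e. there exists 0 ≠ v ∈ V and a grouplike g ∈ H with δ(v) = g ⊗ v. -/

import Mathlib

open TensorProduct

/-- The generators `a, a⁻¹, b, d, d⁻¹` of `O_nc(B⁺) = k⟨a^{±1}, b⟩[d^{±1}]`. -/
inductive BpGen : Type
  | a : BpGen
  | ai : BpGen
  | b : BpGen
  | d : BpGen
  | di : BpGen
  deriving DecidableEq

open BpGen

namespace BpRel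

variable (k : Type) [Field k]

local notation "ι" => FreeAlgebra.ι k (X := BpGen)

/-- The defining relations of `O_nc(B⁺)`. -/
inductive rel : FreeAlgebra k BpGen → FreeAlgebra k BpGen → Prop
  | aai : rel (ι a * ι ai) 1
  | aia : rel (ι ai * ι a) 1
  | ddi : rel (ι d * ι di) 1
  | did : rel (ι di * ι d) 1
  | da : rel (ι d * ι a) (ι a * ι d)
  | db : rel (ι d * ι b) (ι b * ι d)
  | dai : rel (ι d * ι ai) (ι ai * ι d)
  | dia : rel (ι di * ι a) (ι a * ι di)
  | dib : rel (ι di * ι b) (ι b * ι di)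
  | diai : rel (ι di * ι ai) (ι ai * ι di)

end BpRel

/-- The algebra `O_nc(B⁺)`. -/
abbrev OncBp (k : Type) [Field k] : Type := RingQuot (BpRel.rel k)

/-- Images of the generators. -/
noncomputable def bg (k : Type) [Field k] (g : BpGen) : OncBp k :=
  RingQuot.mkAlgHom k (BpRel.rel k) (FreeAlgebra.ι k g)

/-- `WordB k n h`: `h` is a word in the generators with exactly `n` letters `b`. -/
inductive WordB (k : Type) [Field k] : ℕ → OncBp k → Prop
  | one : WordB k 0 1
  | gen (g : BpGen) (hg : g ≠ b) {n : ℕ} {h : OncBp k} : WordB k n h → WordB k n (bg k g * h)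
  | bee {n : ℕ} {h : OncBp k} : WordB k n h → WordB k (n + 1) (bg k b * h)

theorem WordB.span_top (k : Type) [Field k] :
    Submodule.span k {h : OncBp k | ∃ n, WordB k n h} = ⊤ := by
  rw [eq_top_iff]
  rintro h -
  obtain ⟨x, rfl⟩ := RingQuot.mkAlgHom_surjective k (BpRel.rel k) h
  suffices H : ∀ y ∈ Submodule.span k {h : OncBp k | ∃ n, WordB k n h},
      RingQuot.mkAlgHom k (BpRel.rel k) x * y ∈
        Submodule.span k {h : OncBp k | ∃ n, WordB k n h} by
    simpa using H 1 (Submodule.subset_span ⟨0, WordB.one⟩)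
  induction x using FreeAlgebra.induction with
  | grade0 r =>
    intro y hy
    rw [AlgHom.commutes, ← Algebra.smul_def]
    exact Submodule.smul_mem _ _ hy
  | grade1 g =>
    intro y hy
    induction hy using Submodule.span_induction with
    | mem y hy =>
      obtain ⟨n, hn⟩ := hy
      apply Submodule.subset_span
      by_cases hg : g = BpGen.b
      · subst hg
        exact ⟨n + 1, WordB.bee hn⟩
      · exact ⟨n, WordB.gen g hg hn⟩
    | zero => simp
    | add y z _ _ h1 h2 => rw [mul_add]; exact Submodule.add_mem _ h1 h2
    | smul r y _ h1 => rw [mul_smul_comm]; exact Submodule.smul_mem _ _ h1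
  | mul x z h1 h2 =>
    intro y hy
    rw [map_mul, mul_assoc]
    exact h1 _ (h2 _ hy)
  | add x z h1 h2 =>
    intro y hy
    rw [map_add, add_mul]
    exact Submodule.add_mem _ (h1 _ hy) (h2 _ hy)

/-- Target of the comultiplication on words with `n` letters `b`. -/
def TB (k : Type) [Field k] (n : ℕ) : Submodule k (OncBp k ⊗[k] OncBp k) :=
  Submodule.span k {t | ∃ x y m, WordB k m y ∧ (m ≤ n ∧ WordB k 0 x ∨ m < n) ∧ t = x ⊗ₜ y}

theorem WordB.comul {k : Type} [Field k]
    (Δ : OncBp k →ₐ[k] OncBp k ⊗[k] OncBp k)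
    (hΔg : ∀ g, g ≠ b → Δ (bg k g) = bg k g ⊗ₜ bg k g)
    (hΔb : Δ (bg k b) = bg k a ⊗ₜ bg k b + bg k b ⊗ₜ bg k d)
    {n : ℕ} {h : OncBp k} (hw : WordB k n h) : Δ h ∈ TB k n := by
  induction hw with
  | one =>
    rw [map_one]
    exact Submodule.subset_span ⟨1, 1, 0, WordB.one, Or.inl ⟨le_rfl, WordB.one⟩, rfl⟩
  | @gen g hg n h _ ih =>
    rw [map_mul, hΔg g hg]
    generalize Δ h = t at ih
    induction ih using Submodule.span_induction with
    | mem t ht =>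
      obtain ⟨x, y, m, hy, hm, rfl⟩ := ht
      rw [Algebra.TensorProduct.tmul_mul_tmul]
      refine Submodule.subset_span ⟨_, _, m, WordB.gen g hg hy, ?_, rfl⟩
      exact hm.imp (fun h => ⟨h.1, WordB.gen g hg h.2⟩) id
    | zero => simp
    | add y z _ _ h1 h2 => rw [mul_add]; exact Submodule.add_mem _ h1 h2
    | smul r y _ h1 => rw [mul_smul_comm]; exact Submodule.smul_mem _ _ h1
  | @bee n h _ ih =>
    rw [map_mul, hΔb]
    generalize Δ h = t at ih
    induction ih using Submodule.span_induction with
    | mem t ht =>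
      obtain ⟨x, y, m, hy, hm, rfl⟩ := ht
      rw [add_mul, Algebra.TensorProduct.tmul_mul_tmul, Algebra.TensorProduct.tmul_mul_tmul]
      refine Submodule.add_mem _ (Submodule.subset_span ⟨_, _, m + 1, WordB.bee hy, ?_, rfl⟩)
        (Submodule.subset_span ⟨_, _, m, WordB.gen d (by decide) hy, ?_, rfl⟩)
      · exact hm.imp (fun h => ⟨by omega, WordB.gen a (by decide) h.2⟩) (by omega)
      · right; omega
    | zero => simp
    | add y z _ _ h1 h2 => rw [mul_add]; exact Submodule.add_mem _ h1 h2
    | smul r y _ h1 => rw [mul_smul_comm]; exact Submodule.smul_mem _ _ h1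

theorem WordB.grouplike {k : Type} [Field k]
    (Δ : OncBp k →ₐ[k] OncBp k ⊗[k] OncBp k)
    (hΔg : ∀ g, g ≠ b → Δ (bg k g) = bg k g ⊗ₜ bg k g)
    {n : ℕ} {h : OncBp k} (hw : WordB k n h) (hn : n = 0) : Δ h = h ⊗ₜ h := by
  induction hw with
  | one => rw [map_one]; rfl
  | gen g hg _ ih => rw [map_mul, hΔg g hg, ih hn, Algebra.TensorProduct.tmul_mul_tmul]
  | bee _ _ => omega

/-- Filtration of `H ⊗ V` by the number of letters `b` (strictly less than `n`). -/
def EB (k : Type) [Field k] (V : Type) [AddCommGroup V] [Module k V] (n : ℕ) :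
    Submodule k (OncBp k ⊗[k] V) :=
  Submodule.span k {t | ∃ h w m, WordB k m h ∧ m < n ∧ t = h ⊗ₜ w}

theorem EB_mono (k : Type) [Field k] (V : Type) [AddCommGroup V] [Module k V] {n m : ℕ}
    (h : n ≤ m) : EB k V n ≤ EB k V m := by
  apply Submodule.span_mono
  rintro t ⟨x, w, l, h1, h2, h3⟩
  exact ⟨x, w, l, h1, by omega, h3⟩

theorem EB_exhaust (k : Type) [Field k] (V : Type) [AddCommGroup V] [Module k V]
    (t : OncBp k ⊗[k] V) : ∃ n, t ∈ EB k V n := by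
  induction t using TensorProduct.induction_on with
  | zero => exact ⟨0, Submodule.zero_mem _⟩
  | add x y hx hy =>
    obtain ⟨n, hn⟩ := hx
    obtain ⟨m, hm⟩ := hy
    exact ⟨max n m, Submodule.add_mem _ (EB_mono k V (le_max_left _ _) hn)
      (EB_mono k V (le_max_right _ _) hm)⟩
  | tmul h w =>
    have hh : h ∈ Submodule.span k {h : OncBp k | ∃ n, WordB k n h} := by
      rw [WordB.span_top]; trivial
    induction hh using Submodule.span_induction with
    | mem h hm =>
      obtain ⟨n, hn⟩ := hm
      exact ⟨n + 1, Submodule.subset_span ⟨h, w, n, hn, by omega, rfl⟩⟩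
    | zero => exact ⟨0, by simp⟩
    | add x y _ _ hx hy =>
      obtain ⟨n, hn⟩ := hx
      obtain ⟨m, hm⟩ := hy
      rw [TensorProduct.add_tmul]
      exact ⟨max n m, Submodule.add_mem _ (EB_mono k V (le_max_left _ _) hn)
        (EB_mono k V (le_max_right _ _) hm)⟩
    | smul r y _ h1 =>
      obtain ⟨n, hn⟩ := h1
      exact ⟨n, by rw [← TensorProduct.smul_tmul']; exact Submodule.smul_mem _ _ hn⟩

/-- Contraction of the first tensor factor by a functional. -/
noncomputable def contrB {k H M : Type} [Field k] [AddCommMonoid H] [Module k H]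
    [AddCommMonoid M] [Module k M] (f : H →ₗ[k] k) : H ⊗[k] M →ₗ[k] M :=
  (TensorProduct.lid k M).toLinearMap ∘ₗ TensorProduct.map f LinearMap.id

theorem contrB_tmul {k H M : Type} [Field k] [AddCommMonoid H] [Module k H]
    [AddCommMonoid M] [Module k M] (f : H →ₗ[k] k) (h : H) (m : M) :
    contrB f (h ⊗ₜ[k] m) = f h • m := by
  simp [contrB]

theorem contrB_nat {k H M N : Type} [Field k] [AddCommMonoid H] [Module k H]
    [AddCommMonoid M] [Module k M] [AddCommMonoid N] [Module k N]
    (f : H →ₗ[k] k) (ρ : M →ₗ[k] N) (t : H ⊗[k] M) :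
    ρ (contrB f t) = contrB f (TensorProduct.map LinearMap.id ρ t) := by
  induction t using TensorProduct.induction_on with
  | zero => simp
  | tmul x y => simp [contrB_tmul]
  | add x y hx hy => simp [hx, hy]

theorem contrB_comul_mem {k : Type} [Field k]
    (Δ : OncBp k →ₐ[k] OncBp k ⊗[k] OncBp k)
    (hΔg : ∀ g, g ≠ b → Δ (bg k g) = bg k g ⊗ₜ bg k g)
    (hΔb : Δ (bg k b) = bg k a ⊗ₜ bg k b + bg k b ⊗ₜ bg k d)
    {V : Type} [AddCommGroup V] [Module k V]
    (f : OncBp k →ₗ[k] k) (hf : ∀ x, WordB k 0 x → f x = 0) {n : ℕ}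
    {t : OncBp k ⊗[k] V} (ht : t ∈ EB k V (n + 1)) :
    contrB f ((TensorProduct.assoc k (OncBp k) (OncBp k) V)
        (TensorProduct.map Δ.toLinearMap LinearMap.id t)) ∈ EB k V n := by
  induction ht using Submodule.span_induction with
  | mem t ht =>
    obtain ⟨h, w, m, hm, hmn, rfl⟩ := ht
    rw [TensorProduct.map_tmul, LinearMap.id_apply, AlgHom.toLinearMap_apply]
    have hD := hm.comul Δ hΔg hΔb
    generalize Δ h = s at hD
    induction hD using Submodule.span_induction with
    | mem s hs =>
      obtain ⟨x, y, l, hy, hl, rfl⟩ := hs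
      rw [TensorProduct.assoc_tmul, contrB_tmul]
      rcases hl with ⟨_, hx⟩ | hl
      · rw [hf x hx, zero_smul]; exact Submodule.zero_mem _
      · exact Submodule.smul_mem _ _ (Submodule.subset_span ⟨y, w, l, hy, by omega, rfl⟩)
    | zero => simp
    | add y z _ _ h1 h2 =>
      rw [TensorProduct.add_tmul, map_add, map_add]; exact Submodule.add_mem _ h1 h2
    | smul r y _ h1 =>
      rw [← TensorProduct.smul_tmul', map_smul, map_smul]; exact Submodule.smul_mem _ _ h1
  | zero => simp
  | add y z _ _ h1 h2 => simp only [map_add]; exact Submodule.add_mem _ h1 h2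
  | smul r y _ h1 => simp only [map_smul]; exact Submodule.smul_mem _ _ h1

/-- Every nonzero finite-dimensional left comodule `V` over
`H = O_nc(B⁺)` (with comultiplication `Δ(a)=a⊗a`, `Δ(d)=d⊗d`, `Δ(b)=a⊗b+b⊗d`
and counit `ε(a)=ε(d)=1`, `ε(b)=0`) contains a semi-invariant: a nonzero `v ∈ V`
with `ρ(v) = g ⊗ v` for some grouplike `g ∈ H`. -/
theorem OncBp_comodule_has_semiinvariant (k : Type) [Field k]
    (Δ : OncBp k →ₐ[k] OncBp k ⊗[k] OncBp k)
    (hΔa : Δ (bg k a) = bg k a ⊗ₜ bg k a)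
    (hΔai : Δ (bg k ai) = bg k ai ⊗ₜ bg k ai)
    (hΔd : Δ (bg k d) = bg k d ⊗ₜ bg k d)
    (hΔdi : Δ (bg k di) = bg k di ⊗ₜ bg k di)
    (hΔb : Δ (bg k b) = bg k a ⊗ₜ bg k b + bg k b ⊗ₜ bg k d)
    (ε : OncBp k →ₐ[k] k)
    (hεa : ε (bg k a) = 1) (hεai : ε (bg k ai) = 1) (hεd : ε (bg k d) = 1)
    (hεdi : ε (bg k di) = 1) (hεb : ε (bg k b) = 0)
    (V : Type) [AddCommGroup V] [Module k V] [FiniteDimensional k V] [Nontrivial V]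
    (ρ : V →ₗ[k] OncBp k ⊗[k] V)
    (hcoassoc : ∀ v, (TensorProduct.assoc k (OncBp k) (OncBp k) V)
        (TensorProduct.map Δ.toLinearMap LinearMap.id (ρ v))
      = TensorProduct.map LinearMap.id ρ (ρ v))
    (hcounit : ∀ v, (TensorProduct.lid k V)
        (TensorProduct.map ε.toLinearMap LinearMap.id (ρ v)) = v) :
    ∃ v : V, v ≠ 0 ∧ ∃ g : OncBp k, g ≠ 0 ∧ Δ g = g ⊗ₜ g ∧ ρ v = g ⊗ₜ v := by
  classical
  have hΔg : ∀ g, g ≠ b → Δ (bg k g) = bg k g ⊗ₜ bg k g := by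
    intro g hg
    cases g with
    | a => exact hΔa
    | ai => exact hΔai
    | b => exact absurd rfl hg
    | d => exact hΔd
    | di => exact hΔdi
  have hinj : ∀ v, ρ v = 0 → v = 0 := by
    intro v hv
    rw [← hcounit v, hv]
    simp
  have hL : ∀ (f : OncBp k →ₗ[k] k) (v : V), ρ (contrB f (ρ v)) =
      contrB f ((TensorProduct.assoc k (OncBp k) (OncBp k) V)
        (TensorProduct.map Δ.toLinearMap LinearMap.id (ρ v))) := by
    intro f v
    rw [contrB_nat, hcoassoc]
  have hex : ∃ n, ∃ v : V, v ≠ 0 ∧ ρ v ∈ EB k V n := by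
    obtain ⟨v, hv⟩ := exists_ne (0 : V)
    obtain ⟨n, hn⟩ := EB_exhaust k V (ρ v)
    exact ⟨n, v, hv, hn⟩
  obtain ⟨v, hv0, hv⟩ := Nat.find_spec hex
  have hmin := fun m => Nat.find_min hex (m := m)
  generalize Nat.find hex = n at hv hmin
  obtain _ | n := n
  · exfalso
    apply hv0
    apply hinj
    have : EB k V 0 = ⊥ := by simp [EB]
    rw [this] at hv
    simpa using hv
  have hkill : ∀ f : OncBp k →ₗ[k] k, (∀ x, WordB k 0 x → f x = 0) → contrB f (ρ v) = 0 := by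
    intro f hf
    by_contra hne
    refine hmin n (Nat.lt_succ_self n) ⟨_, hne, ?_⟩
    rw [hL]
    exact contrB_comul_mem Δ hΔg hΔb f hf hv
  obtain ⟨S, hSW, hspan, hSli⟩ := exists_linearIndependent k {x : OncBp k | WordB k 0 x}
  have hSli' : LinearIndepOn k id S := hSli
  let B := Module.Basis.extend hSli'
  obtain ⟨c, hc⟩ := TensorProduct.eq_repr_basis_left B (ρ v)
  have hcoef : ∀ j, contrB (B.coord j) (ρ v) = c j := by
    intro j
    rw [← hc, Finsupp.sum, map_sum]
    simp only [contrB_tmul, Module.Basis.coord_apply, Module.Basis.repr_self,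
      Finsupp.single_apply, ite_smul, one_smul, zero_smul]
    simp
    exact fun h => h.symm
  have hc0 : c ≠ 0 := by
    rintro rfl
    exact hv0 (hinj v (by rw [← hc]; simp))
  have hcS : ∀ j, c j ≠ 0 → WordB k 0 (B j) := by
    intro j hj
    have hBj : B j = (j : OncBp k) := by simp [B]
    rw [hBj]
    apply hSW
    by_contra hjS
    apply hj
    rw [← hcoef j]
    apply hkill
    intro x hx
    have hx' : x ∈ Submodule.span k S := by
      rw [hspan]; exact Submodule.subset_span hx
    have hle : Submodule.span k S ≤ LinearMap.ker (B.coord j) := by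
      rw [Submodule.span_le]
      intro x hxS
      have hxe : x = B ⟨x, hSli'.subset_extend _ hxS⟩ := by simp [B]
      rw [SetLike.mem_coe, LinearMap.mem_ker, hxe, Module.Basis.coord_apply,
        Module.Basis.repr_self, Finsupp.single_apply, if_neg]
      rintro rfl
      exact hjS hxS
    exact hle hx'
  obtain ⟨j, hj⟩ := Finsupp.ne_iff.mp hc0
  rw [Finsupp.zero_apply] at hj
  refine ⟨c j, hj, B j, B.ne_zero j, (hcS j hj).grouplike Δ hΔg rfl, ?_⟩
  rw [← hcoef j, hL, hcoef j, ← hc, Finsupp.sum, map_sum, map_sum, map_sum]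
  rw [Finset.sum_eq_single j]
  · rw [TensorProduct.map_tmul, AlgHom.toLinearMap_apply, (hcS j hj).grouplike Δ hΔg rfl,
      TensorProduct.assoc_tmul, contrB_tmul]
    simp
  · intro i hi hij
    rw [TensorProduct.map_tmul, AlgHom.toLinearMap_apply,
      (hcS i (Finsupp.mem_support_iff.mp hi)).grouplike Δ hΔg rfl,
      TensorProduct.assoc_tmul, contrB_tmul, Module.Basis.coord_apply,
      Module.Basis.repr_self, Finsupp.single_apply, if_neg hij, zero_smul]
  · intro hns
    exact absurd (Finsupp.mem_support_iff.mpr hj) hns
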